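/- Let n ≥ 2 and let T be a tree on n vertices that is not isomorphic to the star S_n = K_{1,n−1}. Then ρ(T) < ρ(S_n); that is, the star S_n is the unique tree on n vertices with maximum Harary spectral radius. -/

import Mathlib

open scoped Classical

noncomputable def hararyMatrix {V : Type*} [Finite V] (G : SimpleGraph V) : Matrix V V ℝ :=
  Matrix.of fun i j => if i = j then 0 else ((G.dist i j : ℝ))⁻¹

noncomputable def hararyRho {V : Type*} [Finite V] (G : SimpleGraph V) : ℝ :=
  letI := Fintype.ofFinite V
  sSup {μ : ℝ | Module.End.HasEigenvalue (Matrix.toLin' (hararyMatrix G)) μ}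

open SimpleGraph Matrix

section Spectrum

variable {V : Type*} [Fintype V]

lemma hararyMatrix_isHermitian (G : SimpleGraph V) : (hararyMatrix G).IsHermitian := by
  ext i j
  simp [hararyMatrix, dist_comm, eq_comm]

lemma hararyRho_eq_sSup_spectrum (G : SimpleGraph V) :
    hararyRho G = sSup (spectrum ℝ (hararyMatrix G)) := by
  have h : hararyRho G =
      sSup {μ : ℝ | Module.End.HasEigenvalue (Matrix.toLin' (hararyMatrix G)) μ} := by
    unfold hararyRho
    congr!
  rw [h, ← Matrix.spectrum_toLin']
  congr 1
  ext μ
  exact Module.End.hasEigenvalue_iff_mem_spectrum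

/-- The spectral radius of the Harary matrix is its largest eigenvalue. -/
lemma isGreatest_hararyRho [Nonempty V] (G : SimpleGraph V) :
    IsGreatest (spectrum ℝ (hararyMatrix G)) (hararyRho G) := by
  have hs := (hararyMatrix_isHermitian G).spectrum_real_eq_range_eigenvalues
  have hfin : (spectrum ℝ (hararyMatrix G)).Finite := hs ▸ Set.finite_range _
  have hne : (spectrum ℝ (hararyMatrix G)).Nonempty := hs ▸ Set.range_nonempty _
  rw [hararyRho_eq_sSup_spectrum]
  exact ⟨hne.csSup_mem hfin, fun _ h => le_csSup hfin.bddAbove h⟩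

lemma exists_hararyMatrix_mulVec_eq [Nonempty V] (G : SimpleGraph V) :
    ∃ x : V → ℝ, x ≠ 0 ∧ hararyMatrix G *ᵥ x = hararyRho G • x := by
  have h := (isGreatest_hararyRho G).1
  rw [← Matrix.spectrum_toLin', ← Module.End.hasEigenvalue_iff_mem_spectrum] at h
  obtain ⟨x, hx⟩ := h.exists_hasEigenvector
  exact ⟨x, hx.2, by simpa using hx.apply_eq_smul⟩

lemma posSemidef_hararyRho_sub [Nonempty V] (G : SimpleGraph V) :
    (hararyRho G • (1 : Matrix V V ℝ) - hararyMatrix G).PosSemidef := by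
  rw [posSemidef_iff_isHermitian_and_spectrum_nonneg]
  refine ⟨(isHermitian_one.smul (by simp [IsSelfAdjoint])).sub (hararyMatrix_isHermitian G), ?_⟩
  rw [← Algebra.algebraMap_eq_smul_one, ← spectrum.singleton_sub_eq]
  rintro _ ⟨_, rfl, μ, hμ, rfl⟩
  exact sub_nonneg.2 ((isGreatest_hararyRho G).2 hμ)

lemma SimpleGraph.Connected.dist_map_le {V W : Type*} {G : SimpleGraph V} {H : SimpleGraph W}
    (hG : G.Connected) (f : G →g H) (i j : V) : H.dist (f i) (f j) ≤ G.dist i j := by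
  obtain ⟨p, hp⟩ := hG.exists_walk_length_eq_dist i j
  exact hp ▸ (dist_le (p.map f)).trans_eq (p.length_map f)

lemma hararyRho_congr {W : Type*} [Fintype W] {G : SimpleGraph V} {H : SimpleGraph W}
    (hG : G.Connected) (e : G ≃g H) : hararyRho G = hararyRho H := by
  have h : Matrix.reindex e.toEquiv e.toEquiv (hararyMatrix G) = hararyMatrix H := by
    ext i j
    have hd : G.dist (e.symm i) (e.symm j) = H.dist i j := by
      refine le_antisymm ((e.connected_iff.1 hG).dist_map_le e.symm.toHom i j) ?_
      simpa using hG.dist_map_le e.toHom (e.symm i) (e.symm j)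
    simp only [hararyMatrix, Matrix.reindex_apply, Matrix.submatrix_apply, Matrix.of_apply]
    by_cases hij : i = j
    · simp [hij]
    · exact (if_neg (e.symm.injective.ne hij)).trans
        ((congrArg (fun k : ℕ => (k : ℝ)⁻¹) hd).trans (if_neg hij).symm)
  rw [hararyRho_eq_sSup_spectrum, hararyRho_eq_sSup_spectrum, ← h]
  congr 1
  exact (AlgEquiv.spectrum_eq (Matrix.reindexAlgEquiv ℝ ℝ e.toEquiv) (hararyMatrix G)).symm

lemma hararyMatrix_nonneg (G : SimpleGraph V) (i j : V) : 0 ≤ hararyMatrix G i j := by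
  simp only [hararyMatrix, Matrix.of_apply]
  split_ifs <;> positivity

lemma hararyMatrix_pos {G : SimpleGraph V} (hG : G.Connected) {i j : V} (hij : i ≠ j) :
    0 < hararyMatrix G i j := by
  have := hG.pos_dist_of_ne hij
  simp only [hararyMatrix, Matrix.of_apply, if_neg hij]
  positivity

lemma dotProduct_mulVec_eq_sum (M : Matrix V V ℝ) (x : V → ℝ) :
    x ⬝ᵥ M *ᵥ x = ∑ i, ∑ j, M i j * (x i * x j) := by
  simp only [dotProduct, mulVec, Finset.mul_sum]
  exact Finset.sum_congr rfl fun i _ => Finset.sum_congr rfl fun j _ => by ring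

lemma sum_hararyMatrix_le [Nonempty V] (G : SimpleGraph V) (x : V → ℝ) :
    ∑ i, ∑ j, hararyMatrix G i j * (x i * x j) ≤ hararyRho G * (x ⬝ᵥ x) := by
  have h := (posSemidef_hararyRho_sub G).dotProduct_mulVec_nonneg x
  rw [star_trivial, sub_mulVec, dotProduct_sub, dotProduct_mulVec_eq_sum (hararyMatrix G),
    smul_mulVec, one_mulVec, dotProduct_smul, smul_eq_mul] at h
  linarith

/-- A nonzero nonnegative maximizer of the Rayleigh quotient is entrywise positive. -/
lemma pos_of_sum_hararyMatrix_eq [Nonempty V] {G : SimpleGraph V} (hG : G.Connected) {x : V → ℝ}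
    (hx : x ≠ 0) (hx0 : ∀ i, 0 ≤ x i)
    (h : ∑ i, ∑ j, hararyMatrix G i j * (x i * x j) = hararyRho G * (x ⬝ᵥ x)) (i : V) :
    0 < x i := by
  have hker := ((posSemidef_hararyRho_sub G).dotProduct_mulVec_zero_iff x).1 (by
    rw [star_trivial, sub_mulVec, dotProduct_sub, dotProduct_mulVec_eq_sum (hararyMatrix G),
      smul_mulVec, one_mulVec, dotProduct_smul, smul_eq_mul, h, sub_self])
  refine (hx0 i).lt_of_ne' fun hi => hx ?_
  have hsum : ∑ j, hararyMatrix G i j * x j = 0 := by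
    have := congrFun hker i
    rw [sub_mulVec, smul_mulVec, one_mulVec] at this
    simpa [hi, mulVec, dotProduct] using this
  rw [Finset.sum_eq_zero_iff_of_nonneg
    fun j _ => mul_nonneg (hararyMatrix_nonneg G i j) (hx0 j)] at hsum
  ext j
  by_cases hij : i = j
  · exact hij ▸ hi
  · exact (mul_eq_zero.1 (hsum j (Finset.mem_univ j))).resolve_left (hararyMatrix_pos hG hij).ne'

end Spectrum

section Star

variable {V : Type*} [Fintype V]

/-- The matrix with zero diagonal, `1` on adjacent pairs and `1 / 2` on the other pairs. -/
noncomputable def hararyBound (G : SimpleGraph V) : Matrix V V ℝ :=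
  Matrix.of fun i j => if i = j then 0 else 2⁻¹ + 2⁻¹ * (if G.Adj i j then 1 else 0)

lemma hararyMatrix_le_hararyBound {G : SimpleGraph V} (hG : G.Connected) (i j : V) :
    hararyMatrix G i j ≤ hararyBound G i j := by
  simp only [hararyMatrix, hararyBound, Matrix.of_apply]
  split_ifs with hij hadj
  · rfl
  · rw [dist_eq_one_iff_adj.2 hadj]
    norm_num
  · have : (2 : ℝ) ≤ G.dist i j := mod_cast hG.one_lt_dist_of_ne_of_not_adj hij hadj
    rw [mul_zero, add_zero]
    gcongr

lemma dist_le_two_of_hararyMatrix_eq {G : SimpleGraph V} {i j : V}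
    (h : hararyMatrix G i j = hararyBound G i j) : G.dist i j ≤ 2 := by
  simp only [hararyMatrix, hararyBound, Matrix.of_apply] at h
  split_ifs at h with hij hadj
  · simp [hij]
  · rw [dist_eq_one_iff_adj.2 hadj]
    norm_num
  · rw [mul_zero, add_zero, _root_.inv_inj] at h
    exact_mod_cast h.le

lemma hararyMatrix_starGraph (r : V) : hararyMatrix (starGraph r) = hararyBound (starGraph r) := by
  ext i j
  refine (hararyMatrix_le_hararyBound (connected_starGraph r) i j).antisymm ?_
  simp only [hararyMatrix, hararyBound, Matrix.of_apply]
  split_ifs with hij hadj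
  · rfl
  · rw [dist_eq_one_iff_adj.2 hadj]
    norm_num
  · rw [starGraph_adj] at hadj
    push Not at hadj
    obtain ⟨hi, hj⟩ := hadj hij
    have h2 : (starGraph r).dist i j ≤ 2 :=
      dist_le (.cons (starGraph_center_adj' hi.symm) (.cons (starGraph_center_adj hj.symm) .nil))
    have h0 := (connected_starGraph r).pos_dist_of_ne hij
    rw [mul_zero, add_zero]
    gcongr
    exact_mod_cast h2

/-- A vertex of a tree has at most one neighbour closer to the root `v`. -/
lemma SimpleGraph.IsTree.parent_unique {V : Type*} {T : SimpleGraph V} (hT : T.IsTree)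
    {v i j k : V}
    (hj : T.Adj i j) (hk : T.Adj i k) (hdj : T.dist v i = T.dist v j + 1)
    (hdk : T.dist v i = T.dist v k + 1) : j = k := by
  obtain ⟨p, hp⟩ := hT.connected.exists_walk_length_eq_dist v j
  obtain ⟨q, hq⟩ := hT.connected.exists_walk_length_eq_dist v k
  have hp' : (p.concat hj.symm).IsPath := Walk.isPath_of_length_eq_dist _ (by simp [hp, hdj])
  have hq' : (q.concat hk.symm).IsPath := Walk.isPath_of_length_eq_dist _ (by simp [hq, hdk])
  have h : p.concat hj.symm = q.concat hk.symm :=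
    (hT.existsUnique_path v i).unique hp' hq'
  simpa using congrArg Walk.penultimate h

lemma sum_adj_le_sum_starGraph_adj {T : SimpleGraph V} (hT : T.IsTree) {y : V → ℝ} {v : V}
    (hy0 : ∀ i, 0 ≤ y i) (hv : ∀ i, y i ≤ y v) :
    ∑ i, ∑ j, (if T.Adj i j then 1 else 0) * (y i * y j) ≤
      ∑ i, ∑ j, (if (starGraph v).Adj i j then 1 else 0) * (y i * y j) := by
  have key (i : V) : ∑ j, (if T.Adj i j ∧ T.dist v i = T.dist v j + 1 then 1 else 0) * (y i * y j)
      ≤ if i = v then 0 else y i * y v := by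
    simp only [ite_mul, one_mul, zero_mul]
    rw [← Finset.sum_filter]
    split_ifs with hi
    · simp [hi]
    · refine (Finset.sum_le_card_nsmul _ _ (y i * y v)
        fun j _ => mul_le_mul_of_nonneg_left (hv j) (hy0 i)).trans ?_
      rw [nsmul_eq_mul]
      refine mul_le_of_le_one_left (mul_nonneg (hy0 i) (hy0 v)) ?_
      exact_mod_cast Finset.card_le_one.2 fun j hj k hk => by
        simp only [Finset.mem_filter, Finset.mem_univ, true_and] at hj hk
        exact hT.parent_unique hj.1 hk.1 hj.2 hk.2
  have hsplit (i j : V) : (if T.Adj i j then (1 : ℝ) else 0) * (y i * y j) =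
      (if T.Adj i j ∧ T.dist v i = T.dist v j + 1 then 1 else 0) * (y i * y j) +
      (if T.Adj j i ∧ T.dist v j = T.dist v i + 1 then 1 else 0) * (y j * y i) := by
    by_cases hadj : T.Adj i j
    · rcases hT.dist_eq_dist_add_one_of_adj v hadj with h | h
      · simp [hadj, h, show T.dist v j ≠ T.dist v j + 1 + 1 by omega]
      · simp [hadj, hadj.symm, h, show T.dist v i ≠ T.dist v i + 1 + 1 by omega, mul_comm]
    · simp [hadj, mt Adj.symm hadj]
  have hstar (i j : V) : (if (starGraph v).Adj i j then (1 : ℝ) else 0) * (y i * y j) =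
      (if j = v then (if i = v then 0 else y i * y j) else 0) +
      (if i = v then (if j = v then 0 else y j * y i) else 0) := by
    by_cases hi : i = v <;> by_cases hj : j = v <;>
      simp [starGraph_adj, hi, hj, mul_comm, Ne.symm]
  calc _ = 2 * ∑ i, ∑ j,
        (if T.Adj i j ∧ T.dist v i = T.dist v j + 1 then 1 else 0) * (y i * y j) := by
        simp only [hsplit, Finset.sum_add_distrib]
        rw [two_mul, Finset.sum_comm (f := fun i j =>
          (if T.Adj j i ∧ T.dist v j = T.dist v i + 1 then (1 : ℝ) else 0) * (y j * y i))]
    _ ≤ 2 * ∑ i, if i = v then 0 else y i * y v := by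
        gcongr with i
        exact key i
    _ = _ := by
        simp only [hstar, Finset.sum_add_distrib]
        rw [two_mul, Finset.sum_comm (f := fun i j =>
          if i = v then (if j = v then (0 : ℝ) else y j * y i) else 0)]
        simp

lemma sum_hararyBound_eq (G : SimpleGraph V) (y : V → ℝ) :
    ∑ i, ∑ j, hararyBound G i j * (y i * y j) =
      ∑ i, ∑ j, (if i = j then 0 else 2⁻¹ * (y i * y j)) +
        2⁻¹ * ∑ i, ∑ j, (if G.Adj i j then 1 else 0) * (y i * y j) := by
  simp only [Finset.mul_sum, ← Finset.sum_add_distrib]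
  refine Finset.sum_congr rfl fun i _ => Finset.sum_congr rfl fun j _ => ?_
  simp only [hararyBound, Matrix.of_apply]
  split_ifs with hij hadj
  · simp [hij] at hadj
  all_goals ring

lemma sum_hararyBound_le_sum_starGraph {T : SimpleGraph V} (hT : T.IsTree) {y : V → ℝ} {v : V}
    (hy0 : ∀ i, 0 ≤ y i) (hv : ∀ i, y i ≤ y v) :
    ∑ i, ∑ j, hararyBound T i j * (y i * y j) ≤
      ∑ i, ∑ j, hararyMatrix (starGraph v) i j * (y i * y j) := by
  rw [hararyMatrix_starGraph, sum_hararyBound_eq, sum_hararyBound_eq]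
  refine add_le_add le_rfl (mul_le_mul_of_nonneg_left ?_ (by norm_num))
  convert! sum_adj_le_sum_starGraph_adj hT hy0 hv

/-- A tree of diameter at most two is a star. -/
lemma SimpleGraph.IsTree.exists_eq_starGraph [Nontrivial V] {T : SimpleGraph V} (hT : T.IsTree)
    (h : ∀ i j, T.dist i j ≤ 2) : ∃ c, T = starGraph c := by
  obtain ⟨l, hl⟩ := hT.exists_vert_degree_one_of_nontrivial
  obtain ⟨c, hlc, hc⟩ := degree_eq_one_iff_existsUnique_adj.1 hl
  have huniv (u : V) (hu : u ≠ c) : T.Adj c u := by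
    by_cases hul : u = l
    · exact hul ▸ hlc.symm
    obtain ⟨p, hp⟩ := hT.connected.exists_walk_length_eq_dist l u
    have hp2 := hp.le.trans (h l u)
    cases p with
    | nil => exact absurd rfl hul
    | cons hadj p =>
      obtain rfl := hc _ hadj
      cases p with
      | nil => exact absurd rfl hu
      | cons hadj' p =>
        cases p with
        | nil => exact hadj'
        | cons _ _ => simp at hp2
  refine ⟨c, ?_⟩
  ext u w
  rw [starGraph_adj]
  refine ⟨fun hadj => ⟨hadj.ne, ?_⟩, ?_⟩
  · by_contra! hne
    refine hT.dist_ne_of_adj c hadj ?_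
    rw [dist_eq_one_iff_adj.2 (huniv u hne.1), dist_eq_one_iff_adj.2 (huniv w hne.2)]
  · rintro ⟨hne, rfl | rfl⟩
    · exact huniv _ hne.symm
    · exact (huniv _ hne).symm

lemma nonempty_starGraph_iso_completeBipartiteGraph {n : ℕ} (c : Fin n) :
    Nonempty (starGraph c ≃g completeBipartiteGraph (Fin 1) (Fin (n - 1))) := by
  have hcard : Fintype.card (Fin n) = Fintype.card (Fin 1 ⊕ Fin (n - 1)) := by
    have := c.pos
    simp only [Fintype.card_fin, Fintype.card_sum]
    omega
  let e₀ := Fintype.equivOfCardEq hcard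
  let e := e₀.trans (Equiv.swap (e₀ c) (Sum.inl 0))
  have hec : e c = Sum.inl 0 := by simp [e]
  have he (i : Fin n) : i = c ↔ (e i).isLeft := by
    rw [← e.injective.eq_iff, hec]
    rcases e i with a | a
    · simp [Subsingleton.elim a 0]
    · simp
  refine ⟨⟨e, fun {i j} => ?_⟩⟩
  rw [starGraph_adj, completeBipartiteGraph_adj, he i, he j]
  have hij : i = j → (e i).isLeft = (e j).isLeft := fun h => h ▸ rfl
  have hij' : (e i).isLeft → (e j).isLeft → i = j := fun h h' =>
    ((he i).2 h).trans ((he j).2 h').symm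
  simp only [← Sum.not_isLeft]
  grind

/-- Every tree that is not a star has smaller Harary spectral radius than the star centred at a
vertex maximizing the absolute value of an extremal eigenvector. -/
lemma exists_hararyRho_lt_hararyRho_starGraph [Nontrivial V] {T : SimpleGraph V} (hT : T.IsTree)
    (hstar : ∀ c, T ≠ starGraph c) : ∃ v : V, hararyRho T < hararyRho (starGraph v) := by
  obtain ⟨x, hx, hTx⟩ := exists_hararyMatrix_mulVec_eq T
  set y : V → ℝ := fun i => |x i| with hy
  have hy0 (i : V) : 0 ≤ y i := abs_nonneg _
  have hyne : y ≠ 0 := fun h => hx (funext fun i => abs_eq_zero.1 (congrFun h i))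
  have hyy : y ⬝ᵥ y = x ⬝ᵥ x := by simp [hy, dotProduct]
  obtain ⟨v, hv⟩ := Finite.exists_max y
  refine ⟨v, lt_of_not_ge fun hle => ?_⟩
  have h₁ := sum_hararyMatrix_le (starGraph v) y
  have h₂ : hararyRho (starGraph v) * (y ⬝ᵥ y) ≤ hararyRho T * (y ⬝ᵥ y) :=
    mul_le_mul_of_nonneg_right hle (Finset.sum_nonneg fun i _ => mul_self_nonneg _)
  have h₃ : hararyRho T * (y ⬝ᵥ y) ≤ ∑ i, ∑ j, hararyMatrix T i j * (y i * y j) := by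
    rw [hyy, ← smul_eq_mul, ← dotProduct_smul, ← hTx, dotProduct_mulVec_eq_sum]
    exact Finset.sum_le_sum fun i _ => Finset.sum_le_sum fun j _ => mul_le_mul_of_nonneg_left
      ((le_abs_self _).trans (abs_mul _ _).le) (hararyMatrix_nonneg T i j)
  have hterm (i j : V) :
      hararyMatrix T i j * (y i * y j) ≤ hararyBound T i j * (y i * y j) :=
    mul_le_mul_of_nonneg_right (hararyMatrix_le_hararyBound hT.connected i j)
      (mul_nonneg (hy0 i) (hy0 j))
  have h₄ : ∑ i, ∑ j, hararyMatrix T i j * (y i * y j) ≤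
      ∑ i, ∑ j, hararyBound T i j * (y i * y j) :=
    Finset.sum_le_sum fun i _ => Finset.sum_le_sum fun j _ => hterm i j
  have h₅ := sum_hararyBound_le_sum_starGraph hT hy0 hv
  have hpos := pos_of_sum_hararyMatrix_eq (connected_starGraph v) hyne hy0 (by linarith)
  have heq : ∑ i, ∑ j, hararyMatrix T i j * (y i * y j) =
      ∑ i, ∑ j, hararyBound T i j * (y i * y j) := by linarith
  rw [Finset.sum_eq_sum_iff_of_le fun i _ => Finset.sum_le_sum fun j _ => hterm i j] at heq
  obtain ⟨c, hc⟩ := hT.exists_eq_starGraph fun i j => by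
    have hi := heq i (Finset.mem_univ i)
    rw [Finset.sum_eq_sum_iff_of_le fun j _ => hterm i j] at hi
    exact dist_le_two_of_hararyMatrix_eq
      (mul_right_cancel₀ (mul_pos (hpos i) (hpos j)).ne' (hi j (Finset.mem_univ j)))
  exact hstar c hc

end Star

/-- The star `S_n = K_{1,n-1}` is the unique tree on `n` vertices maximizing the Harary
spectral radius: every other tree has strictly smaller Harary spectral radius. -/
theorem harary_rho_tree_lt_star (n : ℕ) (hn : 2 ≤ n) (T : SimpleGraph (Fin n))
    (hT : T.IsTree)
    (hniso : ¬ Nonempty (T ≃g completeBipartiteGraph (Fin 1) (Fin (n - 1)))) :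
    hararyRho T < hararyRho (completeBipartiteGraph (Fin 1) (Fin (n - 1))) := by
  have : Nontrivial (Fin n) := Fin.nontrivial_iff_two_le.2 hn
  obtain ⟨v, hv⟩ := exists_hararyRho_lt_hararyRho_starGraph hT fun c hc =>
    hniso (hc ▸ nonempty_starGraph_iso_completeBipartiteGraph c)
  obtain ⟨e⟩ := nonempty_starGraph_iso_completeBipartiteGraph v
  rwa [← hararyRho_congr (connected_starGraph v) e]
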